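/- Define f : (0,1] → ℝ by f(t) = √(2(t² + 2t)/π) − (1/2)(√(4t/π) + √(4(t²+t)/π)). Then f is strictly increasing on (0,1] and attains its maximum on (0,1] uniquely at t = 1. -/

import Mathlib

open Real

/-- The (rescaled) distance covariance function of the Brownian motion vs Brownian motion
with random linear trend model. -/
noncomputable def f7 (t : ℝ) : ℝ :=
  Real.sqrt (2 * (t ^ 2 + 2 * t) / Real.pi) -
    (1 / 2) * (Real.sqrt (4 * t / Real.pi) + Real.sqrt (4 * (t ^ 2 + t) / Real.pi))

lemma f7_eq (t : ℝ) (ht : 0 < t) :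
    f7 t = Real.sqrt t * (Real.sqrt (2 * t + 4) - 1 - Real.sqrt (t + 1)) / Real.sqrt Real.pi := by
  have h4 : Real.sqrt 4 = 2 := by
    rw [show (4 : ℝ) = 2 ^ 2 by norm_num]
    exact Real.sqrt_sq (by norm_num)
  have e1 : 2 * (t ^ 2 + 2 * t) = t * (2 * t + 4) := by ring
  have e2 : 4 * (t ^ 2 + t) = 4 * (t * (t + 1)) := by ring
  unfold f7
  rw [e1, e2, Real.sqrt_div (by positivity), Real.sqrt_div (by positivity),
    Real.sqrt_div (by positivity), Real.sqrt_mul ht.le, Real.sqrt_mul (by norm_num) t,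
    Real.sqrt_mul (by norm_num) (t * (t + 1)), Real.sqrt_mul ht.le, h4]
  ring

lemma f7_g_lt (a b : ℝ) (ha : 0 ≤ a) (hab : a < b) :
    Real.sqrt (2 * a + 4) - 1 - Real.sqrt (a + 1)
      < Real.sqrt (2 * b + 4) - 1 - Real.sqrt (b + 1) := by
  have A := Real.sq_sqrt (show 0 ≤ 2 * a + 4 by linarith)
  have A' := Real.sq_sqrt (show 0 ≤ 2 * b + 4 by linarith)
  have B := Real.sq_sqrt (show 0 ≤ a + 1 by linarith)
  have B' := Real.sq_sqrt (show 0 ≤ b + 1 by linarith)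
  have pA := Real.sqrt_pos.2 (show 0 < 2 * a + 4 by linarith)
  have pA' := Real.sqrt_pos.2 (show 0 < 2 * b + 4 by linarith)
  have pB := Real.sqrt_pos.2 (show 0 < a + 1 by linarith)
  have pB' := Real.sqrt_pos.2 (show 0 < b + 1 by linarith)
  have hB : Real.sqrt (a + 1) < Real.sqrt (b + 1) :=
    Real.sqrt_lt_sqrt (by linarith) (by linarith)
  generalize Real.sqrt (2 * a + 4) = x at *
  generalize Real.sqrt (2 * b + 4) = x' at *
  generalize Real.sqrt (a + 1) = y at *
  generalize Real.sqrt (b + 1) = y' at *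
  have h1 : x ≤ 2 * y := by nlinarith
  have h2 : x' < 2 * y' := by nlinarith
  have h3 : (x' - x) * (x' + x) = (y' - y) * (2 * y' + 2 * y) := by nlinarith
  have h4 : (y' - y) * (x' + x) < (y' - y) * (2 * y' + 2 * y) :=
    mul_lt_mul_of_pos_left (by linarith) (by linarith)
  have h5 : y' - y < x' - x :=
    lt_of_mul_lt_mul_right (by rw [h3]; exact h4) (by linarith : 0 ≤ x' + x)
  linarith

lemma f7_lt (a b : ℝ) (ha : 0 < a) (hab : a < b) : f7 a < f7 b := by
  rw [f7_eq a ha, f7_eq b (ha.trans hab)]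
  have h0 := f7_g_lt 0 a le_rfl ha
  have h4 : Real.sqrt (2 * 0 + 4) = 2 := by
    rw [show (2 * 0 + 4 : ℝ) = 2 ^ 2 by norm_num]
    exact Real.sqrt_sq (by norm_num)
  have h1 : Real.sqrt (0 + 1) = 1 := by simp
  rw [h4, h1] at h0
  apply div_lt_div_of_pos_right _ (Real.sqrt_pos.2 Real.pi_pos)
  exact mul_lt_mul'' (Real.sqrt_lt_sqrt ha.le hab) (f7_g_lt a b ha.le hab)
    (Real.sqrt_nonneg a) (by linarith)

/-- `f7` is strictly increasing on `(0,1]` and attains its maximum there uniquely at `t = 1`. -/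
theorem stmt7 :
    StrictMonoOn f7 (Set.Ioc 0 1) ∧
      ∀ t ∈ Set.Ioc (0 : ℝ) 1, t ≠ 1 → f7 t < f7 1 := by
  exact ⟨fun a ha b _ hab => f7_lt a b ha.1 hab,
    fun t ht h1 => f7_lt t 1 ht.1 (lt_of_le_of_ne ht.2 h1)⟩
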